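/- Let K ∈ ℝ_{>0}^{k × k_v}, μ ∈ ℝ_{>0}^{k} a positive probability vector, m ∈ ℝ_{>0}^{k_v} with Q_{m,ε} nonempty, let Π(s) be the unique minimizer of KL(q ∥ s) over q ∈ Q_{m,ε}, and T(v) := Π( Kᵀ(μ/(Kv)) ) / ( Kᵀ(μ/(Kv)) ) (componentwise operations). Set c := τ(Kᵀ) · τ(K). Suppose v* ∈ ℝ_{>0}^{k_v} is a fixed point of T. Then for every initial v⁽⁰⁾ ∈ ℝ_{>0}^{k_v} and every t ∈ ℕ, the iterates v⁽ᵗ⁾ = Tᵗ(v⁽⁰⁾) satisfy d_H(v⁽ᵗ⁾, v*) ≤ cᵗ · d_H(v⁽⁰⁾, v*); moreover, with s⁽ᵗ⁾ := Kᵀ(μ/(Kv⁽ᵗ⁾)), q⁽ᵗ⁾ := Π(s⁽ᵗ⁾), s* := Kᵀ(μ/(Kv*)), q* := Π(s*), we have v* = q*/s* componentwise and Σ_j q⁽ᵗ⁾_j log(q⁽ᵗ⁾_j / q*_j) ≤ 2 c^{t+1} · d_H(v⁽⁰⁾, v*). -/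

import Mathlib

open Finset

/-- A probability vector on `Fin n`. -/
def IsProbVec {n : ℕ} (μ : Fin n → ℝ) : Prop :=
  (∀ i, 0 ≤ μ i) ∧ ∑ i, μ i = 1

/-- The LDP polytope `Q_{m,ε}`. -/
def LDPpolytope {kv : ℕ} (ε : ℝ) (m : Fin kv → ℝ) : Set (Fin kv → ℝ) :=
  {ν | IsProbVec ν ∧ ∀ j, Real.exp (-ε / 2) * m j ≤ ν j ∧ ν j ≤ Real.exp (ε / 2) * m j}

/-- Hilbert projective metric on positive vectors. -/
noncomputable def hilbertDist {n : ℕ} (x y : Fin n → ℝ) : ℝ :=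
  Real.log ((⨆ i, x i / y i) / (⨅ i, x i / y i))

/-- Vector KL divergence `Σ_j q_j log(q_j/x_j)` (convention `0 · log 0 = 0`). -/
noncomputable def KLvec {n : ℕ} (q x : Fin n → ℝ) : ℝ :=
  ∑ j, q j * Real.log (q j / x j)

/-- Birkhoff contraction coefficient of a positive matrix: the best Lipschitz constant
of `x ↦ Ax` on positive vectors with respect to the Hilbert projective metric. -/
noncomputable def birkhoffCoeff {a b : ℕ} (A : Fin a → Fin b → ℝ) : ℝ :=
  sSup {r | ∃ x y : Fin b → ℝ, (∀ j, 0 < x j) ∧ (∀ j, 0 < y j) ∧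
    (¬ ∃ c : ℝ, 0 < c ∧ x = c • y) ∧
    r = hilbertDist (fun i => ∑ j, A i j * x j) (fun i => ∑ j, A i j * y j) /
        hilbertDist x y}


section Hilbert

variable {n : ℕ} {x y : Fin n → ℝ}

theorem hilbertDist_le_log [Nonempty (Fin n)] {lo hi : ℝ} (hx : ∀ i, 0 < x i)
    (hy : ∀ i, 0 < y i) (hlo : 0 < lo) (h : ∀ i, lo * y i ≤ x i ∧ x i ≤ hi * y i) :
    hilbertDist x y ≤ Real.log (hi / lo) := by
  have h1 : (⨆ i, x i / y i) ≤ hi := ciSup_le fun i => (div_le_iff₀ (hy i)).2 (h i).2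
  have h2 : lo ≤ ⨅ i, x i / y i := le_ciInf fun i => (le_div_iff₀ (hy i)).2 (h i).1
  have h3 : 0 < ⨆ i, x i / y i := by
    obtain ⟨i⟩ := ‹Nonempty (Fin n)›
    exact (div_pos (hx i) (hy i)).trans_le (le_ciSup (f := fun i => x i / y i)
      (Set.finite_range _).bddAbove i)
  refine Real.log_le_log (div_pos h3 (hlo.trans_le h2)) ?_
  exact div_le_div₀ (h3.le.trans h1) h1 hlo h2

theorem exists_bounds_hilbertDist_eq [Nonempty (Fin n)] (hx : ∀ i, 0 < x i)
    (hy : ∀ i, 0 < y i) :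
    ∃ lo hi : ℝ, 0 < lo ∧ lo ≤ hi ∧ (∀ i, lo * y i ≤ x i ∧ x i ≤ hi * y i) ∧
      hilbertDist x y = Real.log (hi / lo) := by
  have hlow : ∀ i, (⨅ i, x i / y i) ≤ x i / y i :=
    fun i => ciInf_le (Set.finite_range fun i => x i / y i).bddBelow i
  have hupp : ∀ i, x i / y i ≤ ⨆ i, x i / y i :=
    fun i => le_ciSup (Set.finite_range fun i => x i / y i).bddAbove i
  refine ⟨⨅ i, x i / y i, ⨆ i, x i / y i, ?_, ?_, fun i => ⟨?_, ?_⟩, rfl⟩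
  · obtain ⟨i, hi⟩ := exists_eq_ciInf_of_finite (f := fun i => x i / y i)
    rw [← hi]
    exact div_pos (hx i) (hy i)
  · obtain ⟨i⟩ := ‹Nonempty (Fin n)›
    exact (hlow i).trans (hupp i)
  · exact (le_div_iff₀ (hy i)).1 (hlow i)
  · exact (div_le_iff₀ (hy i)).1 (hupp i)

theorem hilbertDist_nonneg [Nonempty (Fin n)] (hx : ∀ i, 0 < x i) (hy : ∀ i, 0 < y i) :
    0 ≤ hilbertDist x y := by
  obtain ⟨lo, hi, hlo, hle, -, h⟩ := exists_bounds_hilbertDist_eq hx hy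
  rw [h]
  exact Real.log_nonneg ((one_le_div hlo).2 hle)

theorem hilbertDist_smul_self [Nonempty (Fin n)] (hy : ∀ i, 0 < y i) {c : ℝ} (hc : 0 < c) :
    hilbertDist (c • y) y = 0 := by
  have hcy : ∀ i, 0 < (c • y) i := fun i => mul_pos hc (hy i)
  refine le_antisymm ?_ (hilbertDist_nonneg hcy hy)
  simpa [hc.ne'] using hilbertDist_le_log (lo := c) (hi := c) hcy hy hc
    fun i => ⟨le_rfl, le_rfl⟩

/-- Entrywise inversion followed by a positive rescaling does not increase the Hilbert metric. -/
theorem hilbertDist_div_le [Nonempty (Fin n)] {w : Fin n → ℝ} (hw : ∀ i, 0 < w i)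
    (hx : ∀ i, 0 < x i) (hy : ∀ i, 0 < y i) :
    hilbertDist (fun i => w i / x i) (fun i => w i / y i) ≤ hilbertDist x y := by
  obtain ⟨lo, hi, hlo, hle, hb, h⟩ := exists_bounds_hilbertDist_eq hx hy
  have hhi : 0 < hi := hlo.trans_le hle
  rw [h, show hi / lo = lo⁻¹ / hi⁻¹ by field_simp]
  refine hilbertDist_le_log (fun i => div_pos (hw i) (hx i)) (fun i => div_pos (hw i) (hy i))
    (inv_pos.2 hhi) fun i => ⟨?_, ?_⟩
  · rw [← div_eq_inv_mul, div_div, mul_comm]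
    exact div_le_div_of_nonneg_left (hw i).le (hx i) (hb i).2
  · rw [← div_eq_inv_mul, div_div, mul_comm]
    exact div_le_div_of_nonneg_left (hw i).le (mul_pos hlo (hy i)) (hb i).1

end Hilbert

section Birkhoff

variable {a b : ℕ} {A : Fin a → Fin b → ℝ} {x y : Fin b → ℝ}

theorem sum_mul_pos_of_pos [Nonempty (Fin b)] (hA : ∀ i j, 0 < A i j) (hx : ∀ j, 0 < x j)
    (i : Fin a) : 0 < ∑ j, A i j * x j :=
  Finset.sum_pos (fun j _ => mul_pos (hA i j) (hx j)) Finset.univ_nonempty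

theorem hilbertDist_sum_mul_le [Nonempty (Fin a)] [Nonempty (Fin b)] (hA : ∀ i j, 0 < A i j)
    (hx : ∀ j, 0 < x j) (hy : ∀ j, 0 < y j) :
    hilbertDist (fun i => ∑ j, A i j * x j) (fun i => ∑ j, A i j * y j) ≤ hilbertDist x y := by
  obtain ⟨lo, hi, hlo, hle, hb, h⟩ := exists_bounds_hilbertDist_eq hx hy
  rw [h]
  refine hilbertDist_le_log (sum_mul_pos_of_pos hA hx) (sum_mul_pos_of_pos hA hy) hlo
    fun i => ⟨?_, ?_⟩ <;> rw [Finset.mul_sum] <;> refine Finset.sum_le_sum fun j _ => ?_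
  · rw [mul_left_comm]
    exact mul_le_mul_of_nonneg_left (hb j).1 (hA i j).le
  · rw [mul_left_comm]
    exact mul_le_mul_of_nonneg_left (hb j).2 (hA i j).le

theorem birkhoffCoeff_nonneg [Nonempty (Fin a)] [Nonempty (Fin b)] (hA : ∀ i j, 0 < A i j) :
    0 ≤ birkhoffCoeff A := by
  refine Real.sSup_nonneg ?_
  rintro r ⟨x, y, hx, hy, -, rfl⟩
  exact div_nonneg (hilbertDist_nonneg (sum_mul_pos_of_pos hA hx) (sum_mul_pos_of_pos hA hy))
    (hilbertDist_nonneg hx hy)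

theorem hilbertDist_sum_mul_le_birkhoffCoeff_mul [Nonempty (Fin a)] [Nonempty (Fin b)]
    (hA : ∀ i j, 0 < A i j) (hx : ∀ j, 0 < x j) (hy : ∀ j, 0 < y j) :
    hilbertDist (fun i => ∑ j, A i j * x j) (fun i => ∑ j, A i j * y j) ≤
      birkhoffCoeff A * hilbertDist x y := by
  rcases (hilbertDist_nonneg hx hy).eq_or_lt with h0 | hpos
  · simpa [← h0] using hilbertDist_sum_mul_le hA hx hy
  rw [← div_le_iff₀ hpos]
  refine le_csSup ⟨1, ?_⟩ ⟨x, y, hx, hy, ?_, rfl⟩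
  · rintro r ⟨x, y, hx, hy, -, rfl⟩
    exact div_le_one_of_le₀ (hilbertDist_sum_mul_le hA hx hy) (hilbertDist_nonneg hx hy)
  · rintro ⟨c, hc, rfl⟩
    exact hpos.ne' (hilbertDist_smul_self hy hc)

end Birkhoff

section Projection

variable {n : ℕ} {ε : ℝ} {m q q' s s' : Fin n → ℝ}

theorem LDPpolytope_pos (hm : ∀ j, 0 < m j) (hq : q ∈ LDPpolytope ε m) (j : Fin n) : 0 < q j :=
  (mul_pos (Real.exp_pos _) (hm j)).trans_le (hq.2 j).1

theorem mul_log_div_sub_le {p q s : ℝ} (hp : 0 < p) (hq : 0 < q) (hs : 0 < s) :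
    p * Real.log (p / s) - q * Real.log (q / s) ≤ (Real.log (p / s) + 1) * (p - q) := by
  have h := Real.log_le_sub_one_of_pos (div_pos hp hq)
  rw [Real.log_div hp.ne' hq.ne'] at h
  have h2 := mul_le_mul_of_nonneg_left h hq.le
  rw [mul_sub q (p / q), mul_div_cancel₀ _ hq.ne'] at h2
  rw [Real.log_div hp.ne' hs.ne', Real.log_div hq.ne' hs.ne']
  linarith

/-- First-order optimality of a KL-projection: mass cannot profitably be moved from a coordinate
above its lower bound to a coordinate below its upper bound. -/
theorem div_le_div_of_KLvec_minimal (hm : ∀ j, 0 < m j) (hs : ∀ j, 0 < s j)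
    (hq : q ∈ LDPpolytope ε m) (hmin : ∀ p ∈ LDPpolytope ε m, KLvec q s ≤ KLvec p s)
    {i j : Fin n} (hi : Real.exp (-ε / 2) * m i < q i) (hj : q j < Real.exp (ε / 2) * m j) :
    q i / s i ≤ q j / s j := by
  by_contra! hlt
  have hij : i ≠ j := by
    rintro rfl
    exact hlt.false
  rw [div_lt_div_iff₀ (hs j) (hs i)] at hlt
  obtain ⟨δ, hδ, hδm⟩ : ∃ δ, 0 < δ ∧ δ < min (min (q i - Real.exp (-ε / 2) * m i)
      (Real.exp (ε / 2) * m j - q j)) ((q i * s j - q j * s i) / (s i + s j)) :=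
    exists_between (lt_min (lt_min (sub_pos.2 hi) (sub_pos.2 hj))
      (div_pos (sub_pos.2 hlt) (add_pos (hs i) (hs j))))
  rw [lt_min_iff, lt_min_iff, lt_div_iff₀ (add_pos (hs i) (hs j))] at hδm
  obtain ⟨⟨h1, h2⟩, h3⟩ := hδm
  set p : Fin n → ℝ := fun l => q l + ((if l = j then δ else 0) - if l = i then δ else 0)
    with hp
  have hpi : p i = q i - δ := by simp [hp, hij]; ring
  have hpj : p j = q j + δ := by simp [hp, hij.symm]
  have hpl : ∀ l, l ≠ i → l ≠ j → p l = q l := fun l hli hlj => by simp [hp, hli, hlj]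
  have hbd : ∀ l, Real.exp (-ε / 2) * m l ≤ p l ∧ p l ≤ Real.exp (ε / 2) * m l := by
    intro l
    have hl := hq.2 l
    by_cases hli : l = i
    · subst hli
      rw [hpi]
      constructor <;> linarith
    by_cases hlj : l = j
    · subst hlj
      rw [hpj]
      constructor <;> linarith
    rwa [hpl l hli hlj]
  have hpos : ∀ l, 0 < p l := fun l => (mul_pos (Real.exp_pos _) (hm l)).trans_le (hbd l).1
  have hmem : p ∈ LDPpolytope ε m := by
    refine ⟨⟨fun l => (hpos l).le, ?_⟩, hbd⟩
    simp [hp, Finset.sum_add_distrib, hq.1.2]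
  have hle : KLvec p s - KLvec q s ≤ δ * (Real.log (p j / s j) - Real.log (p i / s i)) := by
    rw [KLvec, KLvec, ← Finset.sum_sub_distrib]
    refine (Finset.sum_le_sum fun l _ =>
      mul_log_div_sub_le (hpos l) (LDPpolytope_pos hm hq l) (hs l)).trans_eq ?_
    have : ∀ l, p l - q l = (if l = j then δ else 0) - if l = i then δ else 0 :=
      fun l => by simp [hp]
    simp only [this, mul_sub, mul_ite, mul_zero, Finset.sum_sub_distrib, Finset.sum_ite_eq',
      Finset.mem_univ, if_true]
    ring
  have hlog : Real.log (p j / s j) < Real.log (p i / s i) := by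
    refine Real.log_lt_log (div_pos (hpos j) (hs j)) ?_
    rw [div_lt_div_iff₀ (hs j) (hs i), hpi, hpj]
    linarith
  have := hmin p hmem
  have := mul_neg_of_pos_of_neg hδ (sub_neg.2 hlog)
  linarith

/-- If `lo * s' ≤ s` entrywise, the scalings `q / s` and `q' / s'` given by the KL-projections
`q` of `s` and `q'` of `s'` satisfy `lo * (q / s) ≤ q' / s'`. -/
theorem mul_div_le_div_of_KLvec_minimal (hm : ∀ j, 0 < m j)
    (hs : ∀ j, 0 < s j) (hs' : ∀ j, 0 < s' j)
    (hq : q ∈ LDPpolytope ε m) (hmin : ∀ p ∈ LDPpolytope ε m, KLvec q s ≤ KLvec p s)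
    (hq' : q' ∈ LDPpolytope ε m) (hmin' : ∀ p ∈ LDPpolytope ε m, KLvec q' s' ≤ KLvec p s')
    {lo : ℝ} (hlo : 0 < lo) (h : ∀ j, lo * s' j ≤ s j) (i : Fin n) :
    lo * (q i / s i) ≤ q' i / s' i := by
  have key : ∀ l, q l ≤ q' l → lo * (q l / s l) ≤ q' l / s' l := by
    intro l hl
    rw [← mul_div_assoc, div_le_div_iff₀ (hs l) (hs' l)]
    have h1 := mul_le_mul_of_nonneg_left (h l) (LDPpolytope_pos hm hq l).le
    have h2 := mul_le_mul_of_nonneg_right hl (hs l).le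
    linarith
  rcases le_or_gt (q i) (q' i) with hi | hi
  · exact key i hi
  obtain ⟨l, -, hl⟩ : ∃ l ∈ Finset.univ, q l < q' l := by
    by_contra! hcon
    have := Finset.sum_lt_sum hcon ⟨i, Finset.mem_univ i, hi⟩
    rw [hq.1.2, hq'.1.2] at this
    exact this.false
  calc lo * (q i / s i) ≤ lo * (q l / s l) :=
        mul_le_mul_of_nonneg_left (div_le_div_of_KLvec_minimal hm hs hq hmin
          ((hq'.2 i).1.trans_lt hi) (hl.trans_le (hq'.2 l).2)) hlo.le
    _ ≤ q' l / s' l := key l hl.le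
    _ ≤ q' i / s' i := div_le_div_of_KLvec_minimal hm hs' hq' hmin'
          ((hq.2 l).1.trans_lt hl) (hi.trans_le (hq.2 i).2)

theorem hilbertDist_KLvec_minimal_div_le [Nonempty (Fin n)] (hm : ∀ j, 0 < m j)
    (hs : ∀ j, 0 < s j) (hs' : ∀ j, 0 < s' j)
    (hq : q ∈ LDPpolytope ε m) (hmin : ∀ p ∈ LDPpolytope ε m, KLvec q s ≤ KLvec p s)
    (hq' : q' ∈ LDPpolytope ε m) (hmin' : ∀ p ∈ LDPpolytope ε m, KLvec q' s' ≤ KLvec p s') :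
    hilbertDist (fun j => q j / s j) (fun j => q' j / s' j) ≤ hilbertDist s s' := by
  obtain ⟨lo, hi, hlo, hle, hb, h⟩ := exists_bounds_hilbertDist_eq hs hs'
  have hhi : 0 < hi := hlo.trans_le hle
  rw [h, show hi / lo = lo⁻¹ / hi⁻¹ by field_simp]
  refine hilbertDist_le_log (fun i => div_pos (LDPpolytope_pos hm hq i) (hs i))
    (fun i => div_pos (LDPpolytope_pos hm hq' i) (hs' i)) (inv_pos.2 hhi) fun i => ⟨?_, ?_⟩
  · exact mul_div_le_div_of_KLvec_minimal hm hs' hs hq' hmin' hq hmin (inv_pos.2 hhi)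
      (fun j => (inv_mul_le_iff₀ hhi).2 (hb j).2) i
  · rw [le_inv_mul_iff₀ hlo]
    exact mul_div_le_div_of_KLvec_minimal hm hs hs' hq hmin hq' hmin' hlo
      (fun j => (hb j).1) i

theorem KLvec_KLvec_minimal_le_hilbertDist [Nonempty (Fin n)] (hm : ∀ j, 0 < m j)
    (hs : ∀ j, 0 < s j) (hs' : ∀ j, 0 < s' j)
    (hq : q ∈ LDPpolytope ε m) (hmin : ∀ p ∈ LDPpolytope ε m, KLvec q s ≤ KLvec p s)
    (hq' : q' ∈ LDPpolytope ε m) (hmin' : ∀ p ∈ LDPpolytope ε m, KLvec q' s' ≤ KLvec p s') :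
    KLvec q q' ≤ hilbertDist s s' := by
  obtain ⟨lo, hi, hlo, hle, hb, h⟩ := exists_bounds_hilbertDist_eq hs hs'
  have hlog : ∀ j, Real.log (q j / q' j) ≤ Real.log (hi / lo) := by
    intro j
    have hqj := LDPpolytope_pos hm hq j
    have hqj' := LDPpolytope_pos hm hq' j
    refine Real.log_le_log (div_pos hqj hqj') ?_
    have h1 := mul_div_le_div_of_KLvec_minimal hm hs hs' hq hmin hq' hmin' hlo
      (fun j => (hb j).1) j
    rw [← mul_div_assoc, div_le_div_iff₀ (hs j) (hs' j)] at h1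
    rw [div_le_div_iff₀ hqj' hlo]
    have h2 := mul_le_mul_of_nonneg_left (hb j).2 hqj'.le
    refine le_of_mul_le_mul_right ?_ (hs' j)
    linarith
  calc KLvec q q' ≤ ∑ j, q j * Real.log (hi / lo) :=
        Finset.sum_le_sum fun j _ => mul_le_mul_of_nonneg_left (hlog j) (hq.1.1 j)
    _ = hilbertDist s s' := by rw [← Finset.sum_mul, hq.1.2, one_mul, h]

end Projection

/-- Linear convergence of the Sinkhorn-type iteration: with
`c = τ(Kᵀ)·τ(K)` and a positive fixed point `v*` of `T`, the iterates satisfy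
`d_H(v⁽ᵗ⁾, v*) ≤ cᵗ d_H(v⁽⁰⁾, v*)`; moreover `v* = q*/s*` componentwise and
`KL(q⁽ᵗ⁾ ‖ q*) ≤ 2 c^{t+1} d_H(v⁽⁰⁾, v*)`. -/
theorem sinkhorn_linear_convergence {k kv : ℕ} (ε : ℝ) (hε : 0 < ε)
    (K : Fin k → Fin kv → ℝ) (hK : ∀ i j, 0 < K i j)
    (μ : Fin k → ℝ) (hμ : ∀ i, 0 < μ i) (hμ1 : ∑ i, μ i = 1)
    (m : Fin kv → ℝ) (hm : ∀ j, 0 < m j)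
    (hQ : (LDPpolytope ε m).Nonempty)
    (Pi : (Fin kv → ℝ) → (Fin kv → ℝ))
    (hPi : ∀ s, (∀ j, 0 < s j) →
      Pi s ∈ LDPpolytope ε m ∧ ∀ q ∈ LDPpolytope ε m, KLvec (Pi s) s ≤ KLvec q s)
    (s : (Fin kv → ℝ) → (Fin kv → ℝ))
    (hs : ∀ v, s v = fun j => ∑ i, K i j * (μ i / ∑ j', K i j' * v j'))
    (T : (Fin kv → ℝ) → (Fin kv → ℝ))
    (hT : ∀ v, T v = fun j => Pi (s v) j / s v j)
    (c : ℝ) (hc : c = birkhoffCoeff (fun j i => K i j) * birkhoffCoeff K)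
    (vstar : Fin kv → ℝ) (hvstar_pos : ∀ j, 0 < vstar j)
    (hfix : T vstar = vstar) :
    (∀ j, vstar j = Pi (s vstar) j / s vstar j) ∧
    ∀ v0 : Fin kv → ℝ, (∀ j, 0 < v0 j) → ∀ t : ℕ,
      hilbertDist (T^[t] v0) vstar ≤ c ^ t * hilbertDist v0 vstar ∧
      ∑ j, Pi (s (T^[t] v0)) j * Real.log (Pi (s (T^[t] v0)) j / Pi (s vstar) j) ≤
        2 * c ^ (t + 1) * hilbertDist v0 vstar := by
  have : Nonempty (Fin k) := by
    by_contra hne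
    rw [not_nonempty_iff] at hne
    simp at hμ1
  have : Nonempty (Fin kv) := by
    obtain ⟨q, hq, -⟩ := hQ
    by_contra hne
    rw [not_nonempty_iff] at hne
    simpa using hq.2
  have hKT : ∀ (j : Fin kv) (i : Fin k), 0 < (fun j i => K i j) j i := fun j i => hK i j
  have hratio : ∀ v : Fin kv → ℝ, (∀ j, 0 < v j) → ∀ i, 0 < μ i / ∑ j', K i j' * v j' :=
    fun v hv i => div_pos (hμ i) (sum_mul_pos_of_pos hK hv i)
  have hspos : ∀ v : Fin kv → ℝ, (∀ j, 0 < v j) → ∀ j, 0 < s v j := by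
    intro v hv j
    rw [hs]
    exact sum_mul_pos_of_pos hKT (hratio v hv) j
  have hTpos : ∀ v : Fin kv → ℝ, (∀ j, 0 < v j) → ∀ j, 0 < T v j := by
    intro v hv j
    rw [hT]
    exact div_pos (LDPpolytope_pos hm (hPi _ (hspos v hv)).1 j) (hspos v hv j)
  have hc0 : 0 ≤ c := hc ▸ mul_nonneg (birkhoffCoeff_nonneg hKT) (birkhoffCoeff_nonneg hK)
  have hscontr : ∀ v : Fin kv → ℝ, (∀ j, 0 < v j) →
      hilbertDist (s v) (s vstar) ≤ c * hilbertDist v vstar := by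
    intro v hv
    rw [hs v, hs vstar, hc, mul_assoc]
    refine (hilbertDist_sum_mul_le_birkhoffCoeff_mul hKT (hratio v hv)
      (hratio vstar hvstar_pos)).trans
      (mul_le_mul_of_nonneg_left ?_ (birkhoffCoeff_nonneg hKT))
    exact (hilbertDist_div_le hμ (sum_mul_pos_of_pos hK hv)
      (sum_mul_pos_of_pos hK hvstar_pos)).trans
      (hilbertDist_sum_mul_le_birkhoffCoeff_mul hK hv hvstar_pos)
  obtain ⟨hqs, hmins⟩ := hPi _ (hspos vstar hvstar_pos)
  have hTcontr : ∀ v : Fin kv → ℝ, (∀ j, 0 < v j) →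
      hilbertDist (T v) vstar ≤ c * hilbertDist v vstar := by
    intro v hv
    obtain ⟨hq, hmin⟩ := hPi _ (hspos v hv)
    have h := hilbertDist_KLvec_minimal_div_le hm (hspos v hv) (hspos vstar hvstar_pos)
      hq hmin hqs hmins
    rw [← hT v, ← hT vstar, hfix] at h
    exact h.trans (hscontr v hv)
  refine ⟨fun j => by rw [← congrFun (hT vstar) j, hfix], fun v0 hv0 t => ?_⟩
  have hiter : ∀ t : ℕ, (∀ j, 0 < T^[t] v0 j) ∧
      hilbertDist (T^[t] v0) vstar ≤ c ^ t * hilbertDist v0 vstar := by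
    intro t
    induction t with
    | zero => exact ⟨hv0, by simp⟩
    | succ t ih =>
      rw [Function.iterate_succ_apply', pow_succ', mul_assoc]
      exact ⟨hTpos _ ih.1, (hTcontr _ ih.1).trans (mul_le_mul_of_nonneg_left ih.2 hc0)⟩
  obtain ⟨hpos, hdist⟩ := hiter t
  refine ⟨hdist, ?_⟩
  obtain ⟨hq, hmin⟩ := hPi _ (hspos _ hpos)
  have hKL : KLvec (Pi (s (T^[t] v0))) (Pi (s vstar)) ≤ c ^ (t + 1) * hilbertDist v0 vstar := by
    rw [pow_succ', mul_assoc]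
    exact ((KLvec_KLvec_minimal_le_hilbertDist hm (hspos _ hpos) (hspos vstar hvstar_pos)
      hq hmin hqs hmins).trans (hscontr _ hpos)).trans (mul_le_mul_of_nonneg_left hdist hc0)
  have hnonneg : 0 ≤ c ^ (t + 1) * hilbertDist v0 vstar :=
    mul_nonneg (pow_nonneg hc0 _) (hilbertDist_nonneg hv0 hvstar_pos)
  refine hKL.trans ?_
  linarith
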